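/- arXiv:2605.26775 — 9 statements merged into one kernel-verified Lean document; each statement's English description precedes it below -/
import Mathlib

section
/- Let R be a commutative ring, m ∈ ℕ, and let A be an invertible m×m matrix over R. Let P and Q be subsets of {1,…,m} with |P| = |Q|, and let P̃ = {1,…,m}∖P and Q̃ = {1,…,m}∖Q. Then det(sub_P^Q A) = (−1)^{ΣP+ΣQ} · det A · det(sub_{Q̃}^{P̃}(A⁻¹)), where ΣP and ΣQ denote the sums of the elements of P and Q respectively. -/
/-- The position of an element of `s` is its rank in `s` plus the number of elements of the
complement below it. -/
theorem Finset.orderEmbOfFin_val_eq_rank_add {k l m : ℕ} (s : Finset (Fin m))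
    (hk : s.card = k) (hl : sᶜ.card = l) (a : Fin k) :
    (s.orderEmbOfFin hk a : ℕ) =
      a + ∑ c : Fin l, if sᶜ.orderEmbOfFin hl c < s.orderEmbOfFin hk a then 1 else 0 := by
  have hcard (n : ℕ) (x : Fin n) : (x : ℕ) = ∑ y : Fin n, if y < x then 1 else 0 := by
    rw [Finset.sum_boole, Finset.filter_gt_eq_Iio, Fin.card_Iio, Nat.cast_id]
  conv_lhs => rw [hcard]
  conv_rhs => rw [hcard k a]
  rw [← (finSumEquivOfFinset hk hl).sum_comp, Fintype.sum_sum_type]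
  simp [-Finset.sum_boole]
  rfl

/-- The sign of the permutation listing the elements of `s` in increasing order, followed by the
elements of its complement in increasing order. -/
theorem sign_finSumEquivOfFinset {k l : ℕ} (s : Finset (Fin (k + l)))
    (hk : s.card = k) (hl : sᶜ.card = l) :
    Equiv.Perm.sign (finSumFinEquiv.symm.trans (finSumEquivOfFinset hk hl)) *
      (-1) ^ (∑ a : Fin k, (a : ℕ)) = (-1) ^ (∑ i ∈ s, (i : ℕ)) := by
  have hsum : ∑ i ∈ s, (i : ℕ) = ∑ a : Fin k, (s.orderEmbOfFin hk a : ℕ) := by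
    conv_lhs => rw [← s.image_orderEmbOfFin_univ hk]
    rw [Finset.sum_image (s.orderEmbOfFin hk).injective.injOn]
  have hne (a : Fin k) (c : Fin l) : s.orderEmbOfFin hk a ≠ sᶜ.orderEmbOfFin hl c := fun h =>
    Finset.mem_compl.1 (sᶜ.orderEmbOfFin_mem hl c) (h ▸ s.orderEmbOfFin_mem hk a)
  have hinv (a : Fin k) (c : Fin l) :
      (if s.orderEmbOfFin hk a < sᶜ.orderEmbOfFin hl c then (1 : ℤˣ) else -1) =
        (-1) ^ (if sᶜ.orderEmbOfFin hl c < s.orderEmbOfFin hk a then 1 else 0) := by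
    rcases (hne a c).lt_or_gt with h | h <;> simp [h, h.not_gt]
  have hle (a b : Fin k) :
      (if Fin.castAdd l a < Fin.castAdd l b then if a < b then (1 : ℤˣ) else -1 else 1) = 1 := by
    have : Fin.castAdd l a < Fin.castAdd l b ↔ a < b := Iff.rfl
    split_ifs <;> simp_all
  have hle' (a b : Fin l) : (if a < b then if a < b then (1 : ℤˣ) else -1 else 1) = 1 := by
    split_ifs <;> rfl
  have hlt (a : Fin k) (c : Fin l) : Fin.castAdd l a < Fin.natAdd k c := by
    simp only [Fin.lt_def, Fin.val_castAdd, Fin.val_natAdd]; omega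
  have hsign : Equiv.Perm.sign (finSumFinEquiv.symm.trans (finSumEquivOfFinset hk hl)) =
      ∏ a : Fin k, ∏ c : Fin l,
        if s.orderEmbOfFin hk a < sᶜ.orderEmbOfFin hl c then (1 : ℤˣ) else -1 := by
    simp_rw [Equiv.Perm.sign_eq_prod_prod_Ioi, ← Finset.filter_lt_eq_Ioi, Finset.prod_filter,
      Fin.prod_univ_add]
    simp [hlt, (hlt _ _).not_gt, hle, hle']
  simp_rw [hsign, hinv, hsum, Finset.prod_pow_eq_pow_sum, ← pow_add, ← Finset.sum_add_distrib]
  congr 1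
  refine Finset.sum_congr rfl fun a _ => ?_
  rw [s.orderEmbOfFin_val_eq_rank_add hk hl, add_comm]

/-- The sign of the permutation matching two subsets of the same cardinality, and their
complements, in increasing order. -/
theorem sign_finSumEquivOfFinset_symm_trans {k l m : ℕ} (s t : Finset (Fin m))
    (hs : s.card = k) (hs' : sᶜ.card = l) (ht : t.card = k) (ht' : tᶜ.card = l) :
    Equiv.Perm.sign ((finSumEquivOfFinset ht ht').symm.trans (finSumEquivOfFinset hs hs')) =
      (-1) ^ ((∑ i ∈ s, ((i : ℕ) + 1)) + ∑ i ∈ t, ((i : ℕ) + 1)) := by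
  obtain rfl : m = k + l := by
    rw [← hs, ← hs', Finset.card_add_card_compl, Fintype.card_fin]
  have h : (finSumEquivOfFinset ht ht').symm.trans (finSumEquivOfFinset hs hs') =
      (finSumFinEquiv.symm.trans (finSumEquivOfFinset hs hs')) *
        (finSumFinEquiv.symm.trans (finSumEquivOfFinset ht ht'))⁻¹ := by
    ext x
    simp [Equiv.Perm.mul_def, Equiv.Perm.inv_def]
  have h₁ := sign_finSumEquivOfFinset s hs hs'
  have h₂ := sign_finSumEquivOfFinset t ht ht'
  rw [h, Equiv.Perm.sign_mul, Equiv.Perm.sign_inv]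
  simp only [Finset.sum_add_distrib, Finset.sum_const, hs, ht, smul_eq_mul, mul_one]
  have hu (u : ℤˣ) (a b c : ℤˣ) (hu : a * u * (b * u) = c) : a * b = c := by
    rw [← hu, mul_mul_mul_comm, Int.units_mul_self, mul_one]
  refine hu _ _ _ _ (congrArg₂ (· * ·) h₁ h₂ |>.trans ?_)
  rw [add_add_add_comm, pow_add _ _ (k + k), ← two_mul k, pow_mul, neg_one_sq, one_pow, mul_one,
    pow_add]

/-- Jacobi's complementary-minor identity for a block matrix `M` with right inverse `N`. -/
theorem Matrix.det_toBlocks₁₁_eq_det_mul_det_toBlocks₂₂ {R n o : Type*} [CommRing R]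
    [Fintype n] [Fintype o] [DecidableEq n] [DecidableEq o] (M N : Matrix (n ⊕ o) (n ⊕ o) R)
    (h : M * N = 1) : M.toBlocks₁₁.det = M.det * N.toBlocks₂₂.det := by
  have hblocks : M * fromBlocks 1 N.toBlocks₁₂ 0 N.toBlocks₂₂ =
      fromBlocks M.toBlocks₁₁ 0 M.toBlocks₂₁ 1 := by
    rw [← M.fromBlocks_toBlocks, ← N.fromBlocks_toBlocks, fromBlocks_multiply, ← fromBlocks_one,
      fromBlocks_inj] at h
    conv_lhs => rw [← M.fromBlocks_toBlocks]
    rw [fromBlocks_multiply]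
    simp [h.2.1, h.2.2.2]
  simpa using (congrArg det hblocks).symm

/-- Jacobi's complementary-minor theorem: for an invertible `m × m`
matrix `A` over a commutative ring and subsets `P, Q` of the row/column indices with
`|P| = |Q|`, the minor of `A` on rows `P` and columns `Q` equals
`(-1)^(ΣP + ΣQ) · det A · (minor of A⁻¹ on rows Q̃ and columns P̃)`.
Indices in `Fin m` represent the elements `1, …, m` (so the `1`-based value of `i : Fin m`
is `(i : ℕ) + 1`). -/
theorem stmt_0 {R : Type*} [CommRing R] {m : ℕ} (A : Matrix (Fin m) (Fin m) R)
    (hA : IsUnit A.det) (P Q : Finset (Fin m)) (hPQ : P.card = Q.card) :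
    Matrix.det (Matrix.of fun a b : Fin P.card =>
        A (P.orderEmbOfFin rfl a) (Q.orderEmbOfFin hPQ.symm b)) =
      (-1 : R) ^ ((∑ i ∈ P, ((i : ℕ) + 1)) + ∑ i ∈ Q, ((i : ℕ) + 1)) * A.det *
        Matrix.det (Matrix.of fun a b : Fin Qᶜ.card =>
          A⁻¹ (Qᶜ.orderEmbOfFin rfl a)
            (Pᶜ.orderEmbOfFin
              (by rw [Finset.card_compl, Finset.card_compl, hPQ]) b)) := by
  have hPQ' : Pᶜ.card = Qᶜ.card := by rw [Finset.card_compl, Finset.card_compl, hPQ]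
  let p := finSumEquivOfFinset (s := P) rfl hPQ'
  let q := finSumEquivOfFinset (s := Q) hPQ.symm rfl
  have hinv : A.submatrix p q * A⁻¹.submatrix q p = 1 := by
    rw [Matrix.submatrix_mul_equiv, Matrix.mul_nonsing_inv A hA, Matrix.submatrix_one_equiv]
  have hdet : (A.submatrix p q).det =
      (-1 : R) ^ ((∑ i ∈ P, ((i : ℕ) + 1)) + ∑ i ∈ Q, ((i : ℕ) + 1)) * A.det := by
    have h := Matrix.det_reindex p.symm q.symm A
    rw [Matrix.reindex_apply, Equiv.symm_symm, Equiv.symm_symm,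
      sign_finSumEquivOfFinset_symm_trans] at h
    simpa using h
  rw [← hdet]
  exact Matrix.det_toBlocks₁₁_eq_det_mul_det_toBlocks₂₂ _ _ hinv
end

section
/- Let R be a commutative ring, k ∈ ℕ, A a k×k matrix over R, and P a subset of {1,…,k}. Then det A = Σ_Q (−1)^{ΣP+ΣQ} · det(sub_P^Q A) · det(sub_{P̃}^{Q̃} A), where the sum ranges over all subsets Q of {1,…,k} with |Q| = |P|, where ΣP and ΣQ are the sums of the elements of P and Q, and where P̃ = {1,…,k}∖P and Q̃ = {1,…,k}∖Q. -/
open Equiv in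
/-- Transposing the adjacent values `a`, `b` of a strictly monotone `f` that misses one of them
preserves strict monotonicity. -/
theorem StrictMono.swap_comp_of_val_add_one_eq {k m : ℕ} {a b : Fin k} (hab : (a : ℕ) + 1 = b)
    {f : Fin m → Fin k} (hf : StrictMono f) (h : (∀ x, f x ≠ a) ∨ ∀ x, f x ≠ b) :
    StrictMono (swap a b ∘ f) := by
  intro x y hxy
  have hlt := hf hxy
  simp only [Function.comp_apply, swap_apply_def]
  simp only [ne_eq, Fin.ext_iff] at h
  split_ifs <;> simp only [Fin.ext_iff, Fin.lt_def] at * <;> grind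

/-- Transposing adjacent values, of which exactly the larger lies in `Q`, commutes with the
order-preserving enumerations of a set and its complement. -/
theorem finSumEquivOfFinset_map_swap {k m n : ℕ} {a b : Fin k} (hab : (a : ℕ) + 1 = b)
    {Q Q' : Finset (Fin k)} (ha : a ∉ Q) (hb : b ∈ Q)
    (hQ : Q' = Q.map (Equiv.swap a b).toEmbedding)
    (hm : Q.card = m) (hn : Qᶜ.card = n) (hm' : Q'.card = m) (hn' : Q'ᶜ.card = n) :
    finSumEquivOfFinset hm' hn' = (finSumEquivOfFinset hm hn).trans (Equiv.swap a b) := by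
  have h₁ := Finset.orderEmbOfFin_unique (s := Q') hm'
    (f := Equiv.swap a b ∘ Q.orderEmbOfFin hm) (by intro x; simp [hQ])
    ((Q.orderEmbOfFin hm).strictMono.swap_comp_of_val_add_one_eq hab
      (.inl fun x hx => ha (hx ▸ Q.orderEmbOfFin_mem hm x)))
  have h₂ := Finset.orderEmbOfFin_unique (s := Q'ᶜ) hn'
    (f := Equiv.swap a b ∘ Qᶜ.orderEmbOfFin hn)
    (by
      intro x
      have := Finset.mem_compl.mp (Qᶜ.orderEmbOfFin_mem hn x)
      simpa only [hQ, Function.comp_apply, Finset.mem_compl, Finset.mem_map_equiv,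
        Equiv.symm_apply_apply] using this)
    ((Qᶜ.orderEmbOfFin hn).strictMono.swap_comp_of_val_add_one_eq hab
      (.inr fun x hx => Finset.mem_compl.mp (hx ▸ Qᶜ.orderEmbOfFin_mem hn x) hb))
  ext x
  rcases x with x | x
  · simpa using congrArg Fin.val (congrFun h₁ x).symm
  · simpa using congrArg Fin.val (congrFun h₂ x).symm

theorem isLowerSet_of_forall_val_add_one {k : ℕ} {Q : Set (Fin k)}
    (h : ∀ a b : Fin k, (a : ℕ) + 1 = b → b ∈ Q → a ∈ Q) : IsLowerSet Q := by
  have key : ∀ (d : ℕ) (a b : Fin k), (a : ℕ) + d = b → b ∈ Q → a ∈ Q := by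
    intro d
    induction d with
    | zero => intro a b hab hb; rwa [Fin.ext (by simpa using hab : (a : ℕ) = b)]
    | succ d ih =>
      intro a b hab hb
      exact h a ⟨a + 1, by omega⟩ rfl (ih _ b (by simp only; omega) hb)
  intro b a hab hb
  exact key (b - a) a b (by rw [Fin.le_def] at hab; omega) hb

/-- Every enumeration of a set followed by its complement can be sorted by adjacent
transpositions into that of a lower set, each changing the sum of the set by one. -/
theorem exists_isLowerSet_sign_finSumEquivOfFinset {k m n : ℕ} (e : Fin m ⊕ Fin n ≃ Fin k)
    (Q : Finset (Fin k)) (hm : Q.card = m) (hn : Qᶜ.card = n) :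
    ∃ (L : Finset (Fin k)) (lm : L.card = m) (ln : Lᶜ.card = n), IsLowerSet (L : Set (Fin k)) ∧
      Equiv.Perm.sign (e.symm.trans (finSumEquivOfFinset hm hn)) *
          (-1) ^ (∑ i ∈ Q, ((i : ℕ) + 1)) =
        Equiv.Perm.sign (e.symm.trans (finSumEquivOfFinset lm ln)) *
          (-1) ^ (∑ i ∈ L, ((i : ℕ) + 1)) := by
  induction hs : ∑ i ∈ Q, ((i : ℕ) + 1) generalizing Q with
  | zero =>
    refine ⟨Q, hm, hn, ?_, by rw [hs]⟩
    have : Q = ∅ := by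
      rw [Finset.eq_empty_iff_forall_notMem]
      intro x hx
      simpa using Finset.sum_eq_zero_iff.mp hs x hx
    simp [this, isLowerSet_empty]
  | succ s ih =>
    by_cases hQ : IsLowerSet (Q : Set (Fin k))
    · exact ⟨Q, hm, hn, hQ, by rw [hs]⟩
    obtain ⟨a, b, hab, hb, ha⟩ : ∃ a b : Fin k, (a : ℕ) + 1 = b ∧ b ∈ Q ∧ a ∉ Q := by
      by_contra! h
      exact hQ (isLowerSet_of_forall_val_add_one h)
    obtain ⟨Q', hQ'⟩ : ∃ Q', Q' = Q.map (Equiv.swap a b).toEmbedding := ⟨_, rfl⟩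
    have hm' : Q'.card = m := by rw [hQ', Finset.card_map, hm]
    have hn' : Q'ᶜ.card = n := by rw [Finset.card_compl, hm', ← hn, Finset.card_compl, hm]
    have hsum : ∑ i ∈ Q', ((i : ℕ) + 1) = s := by
      have h₁ : ∑ i ∈ Q.erase b, ((Equiv.swap a b i : ℕ) + 1) =
          ∑ i ∈ Q.erase b, ((i : ℕ) + 1) := by
        refine Finset.sum_congr rfl fun i hi => ?_
        rw [Finset.mem_erase] at hi
        rw [Equiv.swap_apply_of_ne_of_ne (ne_of_mem_of_not_mem hi.2 ha) hi.1]
      rw [hQ', Finset.sum_map, ← Finset.add_sum_erase _ _ hb]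
      rw [← Finset.add_sum_erase _ _ hb] at hs
      simp only [Equiv.coe_toEmbedding, Equiv.swap_apply_right, h₁]
      omega
    obtain ⟨L, lm, ln, hL, h⟩ := ih Q' hm' hn' hsum
    refine ⟨L, lm, ln, hL, ?_⟩
    rw [← h, finSumEquivOfFinset_map_swap hab ha hb hQ' hm hn hm' hn', ← Equiv.trans_assoc,
      Equiv.Perm.sign_trans, Equiv.Perm.sign_swap (by rintro rfl; omega), pow_succ]
    simp

/-- The sign of the permutation mapping `P` to `Q` and `Pᶜ` to `Qᶜ` in increasing order. -/
theorem sign_finSumEquivOfFinset_s4 {k m n : ℕ} {P Q : Finset (Fin k)}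
    (pm : P.card = m) (pn : Pᶜ.card = n) (qm : Q.card = m) (qn : Qᶜ.card = n) :
    Equiv.Perm.sign ((finSumEquivOfFinset pm pn).symm.trans (finSumEquivOfFinset qm qn)) =
      (-1) ^ ((∑ i ∈ P, ((i : ℕ) + 1)) + ∑ i ∈ Q, ((i : ℕ) + 1)) := by
  obtain ⟨L, lm, ln, hL, h₁⟩ :=
    exists_isLowerSet_sign_finSumEquivOfFinset (finSumEquivOfFinset pm pn) P pm pn
  obtain ⟨L', lm', ln', hL', h₂⟩ :=
    exists_isLowerSet_sign_finSumEquivOfFinset (finSumEquivOfFinset pm pn) Q qm qn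
  obtain rfl : L = L' := by
    rcases hL.total hL' with h | h
    · exact Finset.eq_of_subset_of_card_le (Finset.coe_subset.mp h) (by omega)
    · exact (Finset.eq_of_subset_of_card_le (Finset.coe_subset.mp h) (by omega)).symm
  rw [← h₁, Equiv.symm_trans_self, Equiv.Perm.sign_refl, one_mul] at h₂
  rw [pow_add, ← h₂, mul_assoc, ← mul_pow]
  simp

/-- The product of two minors as a sum over the permutations matching their index sets. -/
theorem Matrix.sign_mul_det_mul_det {R α m n : Type*} [CommRing R] [Fintype α] [DecidableEq α]
    [Fintype m] [DecidableEq m] [Fintype n] [DecidableEq n] (A : Matrix α α R)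
    (e f : m ⊕ n ≃ α) :
    ((Equiv.Perm.sign (e.symm.trans f) : ℤ) : R) *
        (Matrix.of fun a b => A (e (.inl a)) (f (.inl b))).det *
        (Matrix.of fun a b => A (e (.inr a)) (f (.inr b))).det =
      ∑ x : Equiv.Perm m × Equiv.Perm n,
        ((Equiv.Perm.sign (e.symm.trans ((Equiv.Perm.sumCongr x.1 x.2).trans f)) : ℤ) : R) *
          ∏ i, A i (e.symm.trans ((Equiv.Perm.sumCongr x.1 x.2).trans f) i) := by
  rw [← Matrix.det_transpose, ← Matrix.det_transpose (Matrix.of fun a b => A (e (.inr a)) _),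
    Matrix.det_apply', Matrix.det_apply', mul_assoc, Finset.sum_mul_sum, Finset.mul_sum,
    Fintype.sum_prod_type]
  refine Finset.sum_congr rfl fun σ _ => ?_
  rw [Finset.mul_sum]
  refine Finset.sum_congr rfl fun τ _ => ?_
  have hs : e.symm.trans ((Equiv.Perm.sumCongr σ τ).trans f) =
      (e.symm.trans ((Equiv.Perm.sumCongr σ τ).trans e)).trans (e.symm.trans f) := by
    ext; simp
  have hc : Equiv.Perm.sign (e.symm.trans ((Equiv.Perm.sumCongr σ τ).trans e)) =
      Equiv.Perm.sign σ * Equiv.Perm.sign τ := by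
    rw [← Equiv.trans_assoc, Equiv.Perm.sign_symm_trans_trans, Equiv.Perm.sign_sumCongr]
  rw [← Equiv.prod_comp e, Fintype.prod_sum_type, hs, Equiv.Perm.sign_trans, hc]
  simp
  ring

/-- A permutation carrying `P` onto `Q` splits along the enumerations of `P` and `Q`. -/
theorem exists_sumCongr_of_map_eq {k m n : ℕ} {P Q : Finset (Fin k)}
    (pm : P.card = m) (pn : Pᶜ.card = n) (qm : Q.card = m) (qn : Qᶜ.card = n)
    (σ : Equiv.Perm (Fin k)) (h : P.map σ.toEmbedding = Q) :
    ∃ x : Equiv.Perm (Fin m) × Equiv.Perm (Fin n),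
      (finSumEquivOfFinset pm pn).symm.trans
        ((Equiv.Perm.sumCongr x.1 x.2).trans (finSumEquivOfFinset qm qn)) = σ := by
  have hmaps : Set.MapsTo
      ((finSumEquivOfFinset pm pn).trans (σ.trans (finSumEquivOfFinset qm qn).symm))
      (Set.range (Sum.inl : Fin m → Fin m ⊕ Fin n)) (Set.range Sum.inl) := by
    rintro _ ⟨x, rfl⟩
    have hx : σ (P.orderEmbOfFin pm x) ∈ Set.range (Q.orderEmbOfFin qm) := by
      rw [Finset.range_orderEmbOfFin, ← h]
      simp
    obtain ⟨y, hy⟩ := hx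
    refine ⟨y, ?_⟩
    simp [Equiv.eq_symm_apply, hy]
  obtain ⟨x, hx⟩ := Equiv.Perm.mem_sumCongrHom_range_of_perm_mapsTo_inl hmaps
  refine ⟨x, ?_⟩
  rw [Equiv.Perm.sumCongrHom_apply] at hx
  rw [hx]
  ext; simp

theorem map_symm_trans_sumCongr_trans {k m n : ℕ} {P Q : Finset (Fin k)}
    (pm : P.card = m) (pn : Pᶜ.card = n) (qm : Q.card = m) (qn : Qᶜ.card = n)
    (x : Equiv.Perm (Fin m) × Equiv.Perm (Fin n)) :
    P.map ((finSumEquivOfFinset pm pn).symm.trans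
        ((Equiv.Perm.sumCongr x.1 x.2).trans (finSumEquivOfFinset qm qn))).toEmbedding = Q := by
  refine Finset.eq_of_subset_of_card_le (fun i hi => ?_) (by rw [Finset.card_map]; omega)
  obtain ⟨j, hj, rfl⟩ := Finset.mem_map.mp hi
  rw [← Finset.mem_coe, ← Finset.range_orderEmbOfFin P pm] at hj
  obtain ⟨y, rfl⟩ := hj
  have hy : (finSumEquivOfFinset pm pn).symm (P.orderEmbOfFin pm y) = Sum.inl y := by
    rw [← finSumEquivOfFinset_inl pm pn, Equiv.symm_apply_apply]
  simp [hy]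

/-- Laplace expansion along the set of rows `P`: for a `k × k` matrix
`A` over a commutative ring and a subset `P` of the row indices,
`det A = Σ_Q (−1)^(ΣP+ΣQ) det(sub_P^Q A) det(sub_{P̃}^{Q̃} A)`, the sum being over all
subsets `Q` of the column indices with `|Q| = |P|`. Indices in `Fin k` represent the
elements `1, …, k` (so the `1`-based value of `i : Fin k` is `(i : ℕ) + 1`). -/
theorem stmt_4 {R : Type*} [CommRing R] {k : ℕ} (A : Matrix (Fin k) (Fin k) R)
    (P : Finset (Fin k)) :
    A.det = ∑ Q ∈ ((Finset.univ : Finset (Fin k)).powersetCard P.card).attach,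
      (-1 : R) ^ ((∑ i ∈ P, ((i : ℕ) + 1)) + ∑ i ∈ Q.1, ((i : ℕ) + 1)) *
        Matrix.det (Matrix.of fun a b : Fin P.card =>
          A (P.orderEmbOfFin rfl a)
            (Q.1.orderEmbOfFin (Finset.mem_powersetCard.mp Q.2).2 b)) *
        Matrix.det (Matrix.of fun a b : Fin Pᶜ.card =>
          A (Pᶜ.orderEmbOfFin rfl a)
            ((Q.1)ᶜ.orderEmbOfFin
              (by rw [Finset.card_compl, Finset.card_compl,
                (Finset.mem_powersetCard.mp Q.2).2]) b)) := by
  have hn (Q : {Q // Q ∈ (Finset.univ : Finset (Fin k)).powersetCard P.card}) :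
      (Q.1)ᶜ.card = Pᶜ.card := by
    rw [Finset.card_compl, Finset.card_compl, (Finset.mem_powersetCard.mp Q.2).2]
  let e := finSumEquivOfFinset (s := P) rfl rfl
  let f (Q : {Q // Q ∈ (Finset.univ : Finset (Fin k)).powersetCard P.card}) :=
    finSumEquivOfFinset (Finset.mem_powersetCard.mp Q.2).2 (hn Q)
  have hterm (Q : {Q // Q ∈ (Finset.univ : Finset (Fin k)).powersetCard P.card}) :=
    A.sign_mul_det_mul_det e (f Q)
  simp only [e, f, sign_finSumEquivOfFinset_s4, finSumEquivOfFinset_inl,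
    finSumEquivOfFinset_inr, Units.val_pow_eq_pow_val, Units.val_neg, Units.val_one,
    Int.cast_pow, Int.cast_neg, Int.cast_one] at hterm
  rw [Finset.sum_congr rfl fun Q _ => hterm Q, ← Finset.sum_product', ← Matrix.det_transpose,
    Matrix.det_apply']
  symm
  refine Finset.sum_bij
    (fun x _ => e.symm.trans ((Equiv.Perm.sumCongr x.2.1 x.2.2).trans (f x.1)))
    (fun _ _ => Finset.mem_univ _) ?_ ?_ (fun _ _ => rfl)
  · rintro ⟨Q, x⟩ - ⟨Q', x'⟩ - h
    obtain rfl : Q = Q' := by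
      apply Subtype.ext
      rw [← map_symm_trans_sumCongr_trans rfl rfl (Finset.mem_powersetCard.mp Q.2).2 (hn Q) x,
        ← map_symm_trans_sumCongr_trans rfl rfl (Finset.mem_powersetCard.mp Q'.2).2 (hn Q') x']
      exact congrArg (fun σ : Equiv.Perm (Fin k) => P.map σ.toEmbedding) h
    have hx : Equiv.Perm.sumCongrHom _ _ x = Equiv.Perm.sumCongrHom _ _ x' := by
      ext1 y
      simpa using Equiv.congr_fun h (e y)
    rw [Equiv.Perm.sumCongrHom_injective hx]
  · intro σ _
    let Q : {Q // Q ∈ (Finset.univ : Finset (Fin k)).powersetCard P.card} :=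
      ⟨P.map σ.toEmbedding, by simp [Finset.mem_powersetCard]⟩
    obtain ⟨x, hx⟩ := exists_sumCongr_of_map_eq rfl rfl
      (Finset.mem_powersetCard.mp Q.2).2 (hn Q) σ rfl
    exact ⟨(Q, x), by simp, hx⟩
end

section
/- Let R be a commutative ring, n, m ∈ ℕ, let x_1,…,x_n, y_1,…,y_m be elements of R, and let a_1, a_2, a_3, … be a sequence of elements of R. Let z = (z_1,…,z_{n+m}) := (x_1,…,x_n, y_1,…,y_m). Then det( (z_i ∣ a)^{(m+n)−j} )_{1 ≤ i,j ≤ n+m} = Σ_{λ ⊆ (m^n)} (−1)^{nm−|λ|} · det( (x_i ∣ a)^{λ_j + n − j} )_{1 ≤ i,j ≤ n} · det( (y_i ∣ a)^{λ̂'_j + m − j} )_{1 ≤ i,j ≤ m}, where the sum ranges over all partitions λ ⊆ (m^n), |λ| = λ_1 + ⋯ + λ_n, λ̂ is the complementary partition λ̂_i := m − λ_{n+1−i} for i ∈ {1,…,n}, and λ̂'_j := #{i ∈ {1,…,n} : λ̂_i ≥ j} for j ∈ {1,…,m}. -/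
/-- The generalized power `(c ∣ a)^r = Π_{k=1}^r (c + a_k)`, where the sequence `a` is
indexed `a 1, a 2, a 3, …`. -/
def gpow {R : Type*} [CommRing R] (a : ℕ → R) (c : R) (r : ℕ) : R :=
  ∏ k ∈ Finset.range r, (c + a (k + 1))

/-- For `l` encoding a partition `λ ⊆ (m^n)`, the map of `Fin (n + m)` listing first the positions
`m - λ_i + i` and then the complementary positions, both in increasing order. -/
def shuffleFun {n m : ℕ} (l : Fin n → Fin (m + 1)) : Fin (n + m) → Fin (n + m) :=
  Fin.append (fun i => ⟨m - (l i : ℕ) + i, by omega⟩)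
    (fun j => ⟨(Finset.univ.filter (fun i : Fin n => m - (l i : ℕ) ≤ j)).card + j, by
      have := Finset.card_le_univ (Finset.univ.filter (fun i : Fin n => m - (l i : ℕ) ≤ j))
      simp only [Fintype.card_fin] at this
      omega⟩)

section shuffle

variable {n m : ℕ} {l : Fin n → Fin (m + 1)}

lemma shuffleFun_castAdd_val (l : Fin n → Fin (m + 1)) (i : Fin n) :
    (shuffleFun l (Fin.castAdd m i) : ℕ) = m - (l i : ℕ) + i := by
  simp [shuffleFun]

lemma shuffleFun_natAdd_val (l : Fin n → Fin (m + 1)) (j : Fin m) :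
    (shuffleFun l (Fin.natAdd n j) : ℕ) =
      (Finset.univ.filter (fun i : Fin n => m - (l i : ℕ) ≤ j)).card + j := by
  simp [shuffleFun]

lemma shuffleFun_castAdd_strictMono (hl : Antitone l) :
    StrictMono (fun i : Fin n => shuffleFun l (Fin.castAdd m i)) := by
  intro i j hij
  have h1 : (l j : ℕ) ≤ l i := hl hij.le
  have h2 : (i : ℕ) < j := hij
  rw [Fin.lt_def, shuffleFun_castAdd_val, shuffleFun_castAdd_val]
  omega

lemma shuffleFun_natAdd_strictMono (l : Fin n → Fin (m + 1)) :
    StrictMono (fun j : Fin m => shuffleFun l (Fin.natAdd n j)) := by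
  intro i j hij
  have h2 : (i : ℕ) < j := hij
  have h1 : (Finset.univ.filter (fun k : Fin n => m - (l k : ℕ) ≤ i)).card ≤
      (Finset.univ.filter (fun k : Fin n => m - (l k : ℕ) ≤ j)).card :=
    Finset.card_le_card (Finset.monotone_filter_right _ fun k _ hk => by omega)
  rw [Fin.lt_def, shuffleFun_natAdd_val, shuffleFun_natAdd_val]
  omega

lemma shuffleFun_castAdd_lt_natAdd (hl : Antitone l) {i : Fin n} {j : Fin m}
    (h : m - (l i : ℕ) ≤ j) :
    shuffleFun l (Fin.castAdd m i) < shuffleFun l (Fin.natAdd n j) := by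
  have h1 : (Finset.Iic i).card ≤
      (Finset.univ.filter (fun k : Fin n => m - (l k : ℕ) ≤ j)).card := by
    refine Finset.card_le_card fun k hk => ?_
    have h2 : (l i : ℕ) ≤ l k := hl (Finset.mem_Iic.mp hk)
    simp only [Finset.mem_filter, Finset.mem_univ, true_and]
    omega
  rw [Fin.card_Iic] at h1
  rw [Fin.lt_def, shuffleFun_castAdd_val, shuffleFun_natAdd_val]
  omega

lemma shuffleFun_natAdd_lt_castAdd (hl : Antitone l) {i : Fin n} {j : Fin m}
    (h : (j : ℕ) < m - (l i : ℕ)) :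
    shuffleFun l (Fin.natAdd n j) < shuffleFun l (Fin.castAdd m i) := by
  have h1 : (Finset.univ.filter (fun k : Fin n => m - (l k : ℕ) ≤ j)).card ≤
      (Finset.Iio i).card := by
    refine Finset.card_le_card fun k hk => ?_
    simp only [Finset.mem_filter, Finset.mem_univ, true_and] at hk
    rw [Finset.mem_Iio]
    by_contra hki
    have h2 : (l k : ℕ) ≤ l i := hl (not_lt.mp hki)
    omega
  rw [Fin.card_Iio] at h1
  rw [Fin.lt_def, shuffleFun_castAdd_val, shuffleFun_natAdd_val]
  omega

lemma shuffleFun_castAdd_lt_natAdd_iff (hl : Antitone l) {i : Fin n} {j : Fin m} :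
    shuffleFun l (Fin.castAdd m i) < shuffleFun l (Fin.natAdd n j) ↔ m - (l i : ℕ) ≤ j :=
  ⟨fun h => by
    by_contra h'
    exact (h.trans (shuffleFun_natAdd_lt_castAdd hl (not_le.mp h'))).false,
  shuffleFun_castAdd_lt_natAdd hl⟩

lemma shuffleFun_castAdd_ne_natAdd (hl : Antitone l) (i : Fin n) (j : Fin m) :
    shuffleFun l (Fin.castAdd m i) ≠ shuffleFun l (Fin.natAdd n j) := by
  rcases le_or_gt (m - (l i : ℕ)) j with h | h
  · exact (shuffleFun_castAdd_lt_natAdd hl h).ne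
  · exact (shuffleFun_natAdd_lt_castAdd hl h).ne'

lemma shuffleFun_bijective (hl : Antitone l) : Function.Bijective (shuffleFun l) := by
  rw [← Finite.injective_iff_bijective]
  intro a b
  refine Fin.addCases (fun i => ?_) (fun i => ?_) a <;>
    refine Fin.addCases (fun j => ?_) (fun j => ?_) b <;> intro h
  · exact congrArg _ ((shuffleFun_castAdd_strictMono hl).injective h)
  · exact absurd h (shuffleFun_castAdd_ne_natAdd hl i j)
  · exact absurd h.symm (shuffleFun_castAdd_ne_natAdd hl j i)
  · exact congrArg _ ((shuffleFun_natAdd_strictMono l).injective h)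

/-- The Grassmannian permutation attached to a partition `λ ⊆ (m^n)`. -/
noncomputable def shuffle (l : {l : Fin n → Fin (m + 1) // Antitone l}) :
    Equiv.Perm (Fin (n + m)) :=
  Equiv.ofBijective (shuffleFun l.1) (shuffleFun_bijective l.2)

lemma shuffle_apply (l : {l : Fin n → Fin (m + 1) // Antitone l}) (k : Fin (n + m)) :
    shuffle l k = shuffleFun l.1 k := rfl

lemma sign_shuffle (l : {l : Fin n → Fin (m + 1) // Antitone l}) :
    Equiv.Perm.sign (shuffle l) = (-1) ^ (n * m - ∑ i, (l.1 i : ℕ)) := by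
  have hsum : n * m - ∑ i, (l.1 i : ℕ) = ∑ i, (m - (l.1 i : ℕ)) := by
    rw [Finset.sum_tsub_distrib _ fun i _ => Fin.is_le (l.1 i)]
    simp
  have hinner (i : Fin n) :
      (∏ j : Fin m, if m - (l.1 i : ℕ) ≤ j then (1 : ℤˣ) else -1) = (-1) ^ (m - (l.1 i : ℕ)) := by
    rw [Finset.prod_ite]
    simp only [Finset.prod_const_one, one_mul, Finset.prod_const, not_le]
    rw [Fin.card_filter_val_lt, min_eq_right (Nat.sub_le _ _)]
  have hsign : Equiv.Perm.sign (shuffle l) = ∏ b : Fin (n + m), ∏ a : Fin (n + m),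
      if a < b then if shuffleFun l.1 a < shuffleFun l.1 b then (1 : ℤˣ) else -1 else 1 := by
    rw [Equiv.Perm.sign_eq_prod_prod_Iio]
    refine Finset.prod_congr rfl fun b _ => ?_
    rw [← Finset.prod_filter]
    exact Finset.prod_congr (by ext; simp) fun _ _ => rfl
  rw [hsign]
  simp only [Fin.prod_univ_add]
  have h1 (i j : Fin n) : (if Fin.castAdd m i < Fin.castAdd m j then
      if shuffleFun l.1 (Fin.castAdd m i) < shuffleFun l.1 (Fin.castAdd m j) then (1 : ℤˣ) else -1
      else 1) = 1 := by
    split_ifs with h h' <;> first | rfl | exact absurd (shuffleFun_castAdd_strictMono l.2 h) h'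
  have h2 (i j : Fin m) : (if Fin.natAdd n i < Fin.natAdd n j then
      if shuffleFun l.1 (Fin.natAdd n i) < shuffleFun l.1 (Fin.natAdd n j) then (1 : ℤˣ) else -1
      else 1) = 1 := by
    split_ifs with h h'
    · rfl
    · exact absurd (shuffleFun_natAdd_strictMono l.1 (by simpa using h)) h'
    · rfl
  have h3 (i : Fin m) (j : Fin n) : ¬ Fin.natAdd n i < Fin.castAdd m j := by
    simp only [Fin.lt_def, Fin.val_natAdd, Fin.val_castAdd]
    omega
  have h4 (i : Fin m) (j : Fin n) : Fin.castAdd m j < Fin.natAdd n i := by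
    simp only [Fin.lt_def, Fin.val_natAdd, Fin.val_castAdd]
    omega
  simp only [h1, h2, h3, h4, if_true, if_false, Finset.prod_const_one, mul_one, one_mul,
    shuffleFun_castAdd_lt_natAdd_iff l.2]
  rw [Finset.prod_comm, hsum, ← Finset.prod_pow_eq_pow_sum]
  exact Finset.prod_congr rfl fun i _ => hinner i

/-- The permutation of `Fin (n + m)` acting as `s` on the first `n` and as `t` on the last `m`
elements. -/
def blockPerm (s : Equiv.Perm (Fin n)) (t : Equiv.Perm (Fin m)) : Equiv.Perm (Fin (n + m)) :=
  finSumFinEquiv.permCongr (Equiv.Perm.sumCongr s t)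

@[simp] lemma blockPerm_castAdd (s : Equiv.Perm (Fin n)) (t : Equiv.Perm (Fin m)) (i : Fin n) :
    blockPerm s t (Fin.castAdd m i) = Fin.castAdd m (s i) := by
  simp [blockPerm, Equiv.permCongr_apply]

@[simp] lemma blockPerm_natAdd (s : Equiv.Perm (Fin n)) (t : Equiv.Perm (Fin m)) (j : Fin m) :
    blockPerm s t (Fin.natAdd n j) = Fin.natAdd n (t j) := by
  simp [blockPerm, Equiv.permCongr_apply]

lemma sign_blockPerm (s : Equiv.Perm (Fin n)) (t : Equiv.Perm (Fin m)) :
    Equiv.Perm.sign (blockPerm s t) = Equiv.Perm.sign s * Equiv.Perm.sign t := by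
  simp [blockPerm, Equiv.Perm.sign_permCongr, Equiv.Perm.sign_sumCongr]

lemma range_shuffle_mul_blockPerm (l : {l : Fin n → Fin (m + 1) // Antitone l})
    (s : Equiv.Perm (Fin n)) (t : Equiv.Perm (Fin m)) :
    Set.range (fun i : Fin n => (shuffle l * blockPerm s t) (Fin.castAdd m i)) =
      Set.range (fun i : Fin n => shuffleFun l.1 (Fin.castAdd m i)) := by
  simp only [Equiv.Perm.mul_apply, blockPerm_castAdd, shuffle_apply]
  exact s.surjective.range_comp (fun i : Fin n => shuffleFun l.1 (Fin.castAdd m i))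

/-- For a permutation of `Fin (n + m)`, the image of the last `m` elements is the complement of
the image of the first `n`. -/
lemma range_natAdd_eq_compl {τ : Fin (n + m) → Fin (n + m)} (hτ : Function.Bijective τ) :
    Set.range (fun j : Fin m => τ (Fin.natAdd n j)) =
      (Set.range (fun i : Fin n => τ (Fin.castAdd m i)))ᶜ := by
  ext k
  obtain ⟨k, rfl⟩ := hτ.surjective k
  simp only [Set.mem_range, Set.mem_compl_iff, hτ.injective.eq_iff]
  refine Fin.addCases (fun i => ?_) (fun j => ?_) k
  · simp only [Fin.castAdd_inj, exists_eq, not_true_eq_false, iff_false, not_exists]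
    intro j h
    have := congrArg Fin.val h
    simp only [Fin.val_natAdd, Fin.val_castAdd] at this
    omega
  · simp only [Fin.natAdd_inj, exists_eq, true_iff, not_exists]
    intro i h
    have := congrArg Fin.val h
    simp only [Fin.val_natAdd, Fin.val_castAdd] at this
    omega

lemma shuffle_mul_blockPerm_injective :
    Function.Injective fun p : {l : Fin n → Fin (m + 1) // Antitone l} ×
      Equiv.Perm (Fin n) × Equiv.Perm (Fin m) => shuffle p.1 * blockPerm p.2.1 p.2.2 := by
  rintro ⟨l, s, t⟩ ⟨l', s', t'⟩ h
  dsimp only at h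
  have hr := range_shuffle_mul_blockPerm l s t
  rw [h, range_shuffle_mul_blockPerm, StrictMono.range_inj
    (shuffleFun_castAdd_strictMono l'.2) (shuffleFun_castAdd_strictMono l.2)] at hr
  obtain rfl : l = l' := by
    refine Subtype.ext (funext fun i => Fin.ext ?_)
    have := congrArg Fin.val (congrFun hr i)
    simp only [shuffleFun_castAdd_val] at this
    omega
  have hb := mul_left_cancel h
  have hs : s = s' := Equiv.ext fun i => by
    simpa using congrArg (fun σ : Equiv.Perm (Fin (n + m)) => σ (Fin.castAdd m i)) hb
  have ht : t = t' := Equiv.ext fun j => by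
    simpa using congrArg (fun σ : Equiv.Perm (Fin (n + m)) => σ (Fin.natAdd n j)) hb
  rw [hs, ht]

lemma exists_perm_strictMono_comp {k : ℕ} {α : Type*} [LinearOrder α] {f : Fin k → α}
    (hf : Function.Injective f) : ∃ s : Equiv.Perm (Fin k), StrictMono (f ∘ s) :=
  ⟨Tuple.sort f, (Tuple.monotone_sort f).strictMono_of_injective
    (hf.comp (Tuple.sort f).injective)⟩

/-- Every strictly increasing `g : Fin n → Fin (n + m)` lists the first `n` values of a shuffle. -/
lemma exists_antitone_of_strictMono {g : Fin n → Fin (n + m)} (hg : StrictMono g) :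
    ∃ l : {l : Fin n → Fin (m + 1) // Antitone l},
      (fun i : Fin n => shuffleFun l.1 (Fin.castAdd m i)) = g := by
  have hgap (i j : ℕ) (hij : i ≤ j) (hj : j < n) :
      (g ⟨i, by omega⟩ : ℕ) + j ≤ g ⟨j, hj⟩ + i := by
    induction j, hij using Nat.le_induction with
    | base => exact le_rfl
    | succ j hij ih =>
      have h1 := ih (by omega)
      have h2 : (g ⟨j, by omega⟩ : ℕ) < g ⟨j + 1, hj⟩ := hg (by simp [Fin.lt_def])
      omega
  have hlow (i : Fin n) : (i : ℕ) ≤ g i := by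
    have := hgap 0 i (Nat.zero_le _) i.isLt
    rw [Fin.eta] at this
    omega
  have hupp (i : Fin n) : (g i : ℕ) ≤ m + i := by
    have hi := i.isLt
    have h1 := hgap i (n - 1) (by omega) (by omega)
    have h2 := (g ⟨n - 1, by omega⟩).isLt
    rw [Fin.eta] at h1
    omega
  refine ⟨⟨fun i => ⟨m + i - g i, ?_⟩, fun i j hij => ?_⟩, funext fun i => Fin.ext ?_⟩
  · have := hlow i
    omega
  · have h1 := hgap i j hij j.isLt
    rw [Fin.eta, Fin.eta] at h1
    have h2 : (i : ℕ) ≤ j := hij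
    rw [Fin.le_def]
    dsimp only
    omega
  · rw [shuffleFun_castAdd_val]
    have h1 := hlow i
    have h2 := hupp i
    dsimp only
    omega

lemma shuffle_mul_blockPerm_surjective :
    Function.Surjective fun p : {l : Fin n → Fin (m + 1) // Antitone l} ×
      Equiv.Perm (Fin n) × Equiv.Perm (Fin m) => shuffle p.1 * blockPerm p.2.1 p.2.2 := by
  intro τ
  obtain ⟨s, hs⟩ := exists_perm_strictMono_comp (f := fun i : Fin n => τ (Fin.castAdd m i))
    (τ.injective.comp (Fin.castAdd_injective n m))
  obtain ⟨t, ht⟩ := exists_perm_strictMono_comp (f := fun j : Fin m => τ (Fin.natAdd n j))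
    (τ.injective.comp (Fin.natAdd_injective m n))
  obtain ⟨l, hl⟩ := exists_antitone_of_strictMono hs
  have hr : (fun j : Fin m => shuffleFun l.1 (Fin.natAdd n j)) =
      (fun j : Fin m => τ (Fin.natAdd n j)) ∘ t := by
    rw [← StrictMono.range_inj (shuffleFun_natAdd_strictMono l.1) ht,
      range_natAdd_eq_compl (shuffleFun_bijective l.2), hl, s.surjective.range_comp,
      t.surjective.range_comp, range_natAdd_eq_compl τ.bijective]
  refine ⟨(l, s⁻¹, t⁻¹), Equiv.ext fun k => ?_⟩
  refine Fin.addCases (fun i => ?_) (fun j => ?_) k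
  · simpa [shuffle_apply] using congrFun hl (s⁻¹ i)
  · simpa [shuffle_apply] using congrFun hr (t⁻¹ j)

/-- Laplace expansion of a determinant along its first `n` rows. -/
lemma det_eq_sum_shuffle {R : Type*} [CommRing R] (M : Matrix (Fin (n + m)) (Fin (n + m)) R) :
    M.det = ∑ l : {l : Fin n → Fin (m + 1) // Antitone l},
      (-1 : R) ^ (n * m - ∑ i, (l.1 i : ℕ)) *
        (Matrix.of fun i j : Fin n =>
          M (Fin.castAdd m i) (shuffleFun l.1 (Fin.castAdd m j))).det *
        (Matrix.of fun i j : Fin m =>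
          M (Fin.natAdd n i) (shuffleFun l.1 (Fin.natAdd n j))).det := by
  have hdet {k : ℕ} (A : Matrix (Fin k) (Fin k) R) :
      A.det = ∑ σ : Equiv.Perm (Fin k), ((Equiv.Perm.sign σ : ℤ) : R) * ∏ i, A i (σ i) := by
    rw [← Matrix.det_transpose, Matrix.det_apply']
    rfl
  rw [hdet, ← Function.Bijective.sum_comp ⟨shuffle_mul_blockPerm_injective,
    shuffle_mul_blockPerm_surjective⟩, Fintype.sum_prod_type]
  refine Finset.sum_congr rfl fun l _ => ?_
  rw [mul_assoc, hdet, hdet, Finset.sum_mul_sum, Fintype.sum_prod_type, Finset.mul_sum]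
  refine Finset.sum_congr rfl fun s _ => ?_
  rw [Finset.mul_sum]
  refine Finset.sum_congr rfl fun t _ => ?_
  simp only [Equiv.Perm.sign_mul, sign_shuffle, sign_blockPerm,
    Fin.prod_univ_add, Equiv.Perm.mul_apply, blockPerm_castAdd, blockPerm_natAdd, shuffle_apply,
    Matrix.of_apply]
  push_cast
  ring

/-- The complementary positions in terms of the conjugate of the complementary partition. -/
lemma add_sub_shuffleFun_natAdd (l : Fin n → Fin (m + 1)) (j : Fin m) :
    (m + n) - ((shuffleFun l (Fin.natAdd n j) : ℕ) + 1) =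
      (Finset.univ.filter (fun i : Fin n => (j : ℕ) + 1 ≤ m - (l i.rev : ℕ))).card
        + (m - ((j : ℕ) + 1)) := by
  have hrev : (Finset.univ.filter (fun i : Fin n => (j : ℕ) + 1 ≤ m - (l i.rev : ℕ))).card =
      (Finset.univ.filter (fun i : Fin n => ¬ m - (l i : ℕ) ≤ j)).card :=
    Finset.card_equiv Fin.revPerm fun i => by
      simp only [Finset.mem_filter, Finset.mem_univ, true_and, Fin.revPerm_apply]
      omega
  have hcard := Finset.card_filter_add_card_filter_not (s := (Finset.univ : Finset (Fin n)))
    (fun i : Fin n => m - (l i : ℕ) ≤ j)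
  rw [Finset.card_univ, Fintype.card_fin] at hcard
  rw [shuffleFun_natAdd_val, hrev]
  omega

end shuffle


/-- With `z = (x_1,…,x_n,y_1,…,y_m)`,
`det((z_i ∣ a)^{(m+n)−j}) = Σ_{λ ⊆ (m^n)} (−1)^{nm−|λ|}
  det((x_i ∣ a)^{λ_j+n−j}) · det((y_i ∣ a)^{λ̂'_j+m−j})`.
Partitions `λ ⊆ (m^n)` are encoded as weakly decreasing functions `Fin n → Fin (m+1)`
(`0`-indexed, so the `1`-based index `j` corresponds to `(j : ℕ) + 1`);
`λ̂_i = m − λ_{n+1−i}` is the complementary partition and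
`λ̂'_j = #{i : λ̂_i ≥ j}` its conjugate. -/
theorem stmt_7 {R : Type*} [CommRing R] (n m : ℕ) (x : Fin n → R) (y : Fin m → R)
    (a : ℕ → R) :
    Matrix.det (Matrix.of fun i j : Fin (n + m) =>
        gpow a (Fin.append x y i) ((m + n) - ((j : ℕ) + 1))) =
      ∑ l ∈ Finset.univ.filter
          (fun l : Fin n → Fin (m + 1) => ∀ i j : Fin n, i ≤ j → l j ≤ l i),
        (-1 : R) ^ (n * m - ∑ i : Fin n, (l i : ℕ)) *
          Matrix.det (Matrix.of fun i j : Fin n =>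
            gpow a (x i) ((l j : ℕ) + (n - ((j : ℕ) + 1)))) *
          Matrix.det (Matrix.of fun i j : Fin m =>
            gpow a (y i)
              ((Finset.univ.filter
                  (fun i' : Fin n => (j : ℕ) + 1 ≤ m - (l i'.rev : ℕ))).card
                + (m - ((j : ℕ) + 1)))) := by
  rw [det_eq_sum_shuffle]
  symm
  refine (Finset.sum_subtype _ (p := Antitone) (fun l => ?_) _).trans
    (Finset.sum_congr rfl fun l _ => ?_)
  · simp only [Finset.mem_filter, Finset.mem_univ, true_and]
    exact Iff.rfl
  · have hexp (j : Fin n) : (m + n) - ((shuffleFun l.1 (Fin.castAdd m j) : ℕ) + 1) =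
        (l.1 j : ℕ) + (n - ((j : ℕ) + 1)) := by
      rw [shuffleFun_castAdd_val]
      omega
    simp only [Matrix.of_apply, Fin.append_left, Fin.append_right, hexp,
      add_sub_shuffleFun_natAdd]
end

section
/- Let R be a commutative ring, n ∈ ℕ, and let A = (a_{i,j})_{1 ≤ i,j ≤ n} be an n×n matrix over R such that a_{i,j} = 1 whenever i = j + 1, and a_{i,j} = 0 whenever i > j + 1. Then det A = Σ_{k=1}^{n} (−1)^{k+1} a_{1,k} · det( a_{i+k, j+k} )_{1 ≤ i,j ≤ n−k}, where for each k the matrix (a_{i+k,j+k})_{1 ≤ i,j ≤ n−k} is the trailing principal (n−k)×(n−k) submatrix of A (and its determinant is 1 when k = n). -/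
/-- If the first `k` columns of `M` are upper triangular with ones on the diagonal, then `det M`
is the determinant of its trailing principal submatrix. -/
theorem Matrix.det_eq_det_trailing_of_unitriangular_columns {R : Type*} [CommRing R]
    {m k l : ℕ} (h : m = l + k) (M : Matrix (Fin m) (Fin m) R) (N : Matrix (Fin l) (Fin l) R)
    (hdiag : ∀ i : Fin m, (i : ℕ) < k → M i i = 1)
    (hbelow : ∀ i j : Fin m, (j : ℕ) < k → j < i → M i j = 0)
    (hN : ∀ i j : Fin l, N i j = M ⟨i + k, by omega⟩ ⟨j + k, by omega⟩) :
    M.det = N.det := by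
  induction k generalizing m with
  | zero =>
    obtain rfl : m = l := h
    congr 1
    ext i j
    exact (hN i j).symm
  | succ k ih =>
    obtain rfl : m = (l + k) + 1 := h
    rw [Matrix.det_succ_column_zero, Finset.sum_eq_single 0]
    · rw [hdiag 0 (Nat.succ_pos k), Fin.succAbove_zero, Fin.val_zero, pow_zero, one_mul, one_mul]
      refine ih rfl _ (fun i hi => hdiag _ (by simpa using hi))
        (fun i j hj hij => hbelow _ _ (by simpa using hj) (by simpa using hij)) hN
    · intro i _ hi
      rw [hbelow i 0 (Nat.succ_pos k) (Fin.pos_of_ne_zero hi), mul_zero, zero_mul]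
    · simp

/-- Expansion along the top row of a Hessenberg-type matrix: if
`a_{i,j} = 1` whenever `i = j + 1` and `a_{i,j} = 0` whenever `i > j + 1` (`1`-based),
then `det A = Σ_{k=1}^n (−1)^{k+1} a_{1,k} det((a_{i+k,j+k})_{1 ≤ i,j ≤ n−k})`.
Here the sum is over `k : Fin n` representing the `1`-based column `(k : ℕ) + 1`, so the
sign `(−1)^{k+1}` (with `1`-based `k`) is `(−1)^{(k : ℕ)}`; the hypothesis `0 < n`
makes the first row `a_{1,·}` (referenced in the formula) exist. -/
theorem stmt_8 {R : Type*} [CommRing R] {n : ℕ} (hn : 0 < n)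
    (a : Matrix (Fin n) (Fin n) R)
    (h1 : ∀ i j : Fin n, (i : ℕ) = (j : ℕ) + 1 → a i j = 1)
    (h0 : ∀ i j : Fin n, (j : ℕ) + 1 < (i : ℕ) → a i j = 0) :
    a.det = ∑ k : Fin n, (-1 : R) ^ (k : ℕ) * a ⟨0, hn⟩ k *
      Matrix.det (Matrix.of fun i j : Fin (n - ((k : ℕ) + 1)) =>
        a ⟨(i : ℕ) + ((k : ℕ) + 1), by have hi := i.isLt; omega⟩
          ⟨(j : ℕ) + ((k : ℕ) + 1), by have hj := j.isLt; omega⟩) := by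
  obtain ⟨m, rfl⟩ : ∃ m, n = m + 1 := ⟨n - 1, by omega⟩
  rw [Matrix.det_succ_row_zero]
  refine Finset.sum_congr rfl fun k _ => ?_
  congr 1
  have hk := k.isLt
  refine Matrix.det_eq_det_trailing_of_unitriangular_columns (k := k) (by omega) _ _
    (fun i hi => ?_) (fun i j hj hij => ?_) fun i j => ?_
  · rw [Matrix.submatrix_apply, Fin.succAbove_of_castSucc_lt _ _ (by simpa [Fin.lt_def] using hi)]
    exact h1 _ _ rfl
  · rw [Matrix.submatrix_apply, Fin.succAbove_of_castSucc_lt _ _ (by simpa [Fin.lt_def] using hj)]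
    exact h0 _ _ (by exact Nat.succ_lt_succ hij)
  · rw [Matrix.submatrix_apply, Fin.succAbove_of_le_castSucc _ _ (by simp [Fin.le_def])]
    rfl
end

section
/- Let R be a commutative ring, n ∈ ℕ, r ∈ {0,…,n}, and let C = (c_{i,j})_{1 ≤ i,j ≤ n} be an n×n matrix over R. Let ω_{r+1} > ω_{r+2} > ⋯ > ω_n be elements of {1,…,n}, and assume c_{i,j} = 0 for all i > r and all j ≠ ω_i. Set Q₁ := {ω_{r+1}, ω_{r+2}, …, ω_n}. Then det C = (−1)^{(n−r)n + (ω_{r+1} + ω_{r+2} + ⋯ + ω_n)} · (Π_{i=r+1}^{n} c_{i,ω_i}) · det( sub_{{1,…,r}}^{{1,…,n}∖Q₁} C ). -/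
open Finset in
/-- Expansion of the determinant along the rows of index at least `r`, each of which has at most
one nonzero entry, the remaining columns being enumerated by an arbitrary strictly increasing
map `e`. -/
theorem Matrix.det_of_single_entry_rows {R : Type*} [CommRing R] {n : ℕ} (r : ℕ) (hr : r ≤ n)
    (C : Matrix (Fin n) (Fin n) R) (w : Fin n → Fin n)
    (hw : ∀ i j : Fin n, r ≤ (i : ℕ) → (i : ℕ) < (j : ℕ) → w j < w i)
    (hC : ∀ i : Fin n, r ≤ (i : ℕ) → ∀ j : Fin n, j ≠ w i → C i j = 0)
    (e : Fin r → Fin n) (he : StrictMono e)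
    (hew : ∀ (k : Fin r) (i : Fin n), r ≤ (i : ℕ) → e k ≠ w i) :
    C.det =
      (-1 : R) ^ ((n - r) * n + ∑ i ∈ univ.filter (fun i : Fin n => r ≤ (i : ℕ)), ((w i : ℕ) + 1)) *
        (∏ i ∈ univ.filter (fun i : Fin n => r ≤ (i : ℕ)), C i (w i)) *
          (C.submatrix (Fin.castLE hr) e).det := by
  induction n with
  | zero =>
    obtain rfl : r = 0 := by omega
    simp
  | succ m ih =>
    rcases hr.eq_or_lt with rfl | hlt
    · have hid : e = id := by
        have := Subsingleton.elim (he.orderIsoOfSurjective e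
          (Finite.surjective_of_injective he.injective)) (OrderIso.refl _)
        funext k
        exact congrArg (fun f : Fin (m + 1) ≃o Fin (m + 1) => f k) this
      have hempty : (univ.filter fun i : Fin (m + 1) => m + 1 ≤ (i : ℕ)) = ∅ := by
        ext i
        simp only [mem_filter, mem_univ, true_and, notMem_empty, iff_false]
        omega
      have hcast : (Fin.castLE hr : Fin (m + 1) → Fin (m + 1)) = id := rfl
      rw [hempty, hid, hcast]
      simp
    · have hrm : r ≤ m := by omega
      set p := w (Fin.last m) with hp
      have hpw : ∀ i : Fin m, r ≤ (i : ℕ) → p < w i.castSucc := fun i hi =>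
        hw i.castSucc (Fin.last m) hi i.isLt
      have hex : ∀ i : Fin m, ∃ j : Fin m, r ≤ (i : ℕ) → p.succAbove j = w i.castSucc := by
        intro i
        by_cases hi : r ≤ (i : ℕ)
        · obtain ⟨j, hj⟩ := Fin.exists_succAbove_eq (hpw i hi).ne'
          exact ⟨j, fun _ => hj⟩
        · exact ⟨i, fun h => absurd h hi⟩
      choose w' hw' using hex
      have hval : ∀ i : Fin m, r ≤ (i : ℕ) → (w i.castSucc : ℕ) = w' i + 1 := by
        intro i hi
        have h := hpw i hi
        rw [← hw' i hi] at h ⊢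
        rw [Fin.succAbove_of_le_castSucc _ _ (Fin.lt_succAbove_iff_le_castSucc _ _ |>.1 h)]
        simp
      have hex' : ∀ k, ∃ j, p.succAbove j = e k := fun k =>
        Fin.exists_succAbove_eq (hew k (Fin.last m) hrm)
      choose e' he' using hex'
      have key := ih hrm (C.submatrix Fin.castSucc p.succAbove) w'
        (fun i j hi hij => by
          rw [← (Fin.strictMono_succAbove p).lt_iff_lt, hw' i hi, hw' j (by omega)]
          exact hw _ _ hi hij)
        (fun i hi j hj => hC i.castSucc hi _ (by
          rw [← hw' i hi]
          exact fun h => hj (Fin.succAbove_right_injective h)))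
        e'
        (fun a b hab => by
          rw [← (Fin.strictMono_succAbove p).lt_iff_lt, he', he']
          exact he hab)
        (fun k i hi h => hew k i.castSucc hi (by rw [← he' k, h, hw' i hi]))
      have hsub : (C.submatrix Fin.castSucc p.succAbove).submatrix (Fin.castLE hrm) e' =
          C.submatrix (Fin.castLE hr) e := by
        ext a b
        simp only [Matrix.submatrix_apply, he']
        rfl
      have hprod : ∏ i ∈ univ.filter (fun i : Fin (m + 1) => r ≤ (i : ℕ)), C i (w i) =
          (∏ i ∈ univ.filter (fun i : Fin m => r ≤ (i : ℕ)),
            C.submatrix Fin.castSucc p.succAbove i (w' i)) *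
            C (Fin.last m) p := by
        rw [prod_filter, prod_filter, Fin.prod_univ_castSucc]
        simp only [Fin.val_castSucc, Fin.val_last, hrm, if_true, Matrix.submatrix_apply]
        congr 1
        refine prod_congr rfl fun i _ => ?_
        split_ifs with hi
        · rw [hw' i hi]
        · rfl
      have hcard : #{i : Fin m | r ≤ (i : ℕ)} = m - r := by
        have := Fin.card_filter_val_lt (n := m) (m := r)
        have h2 := card_filter_add_card_filter_not (s := (univ : Finset (Fin m)))
          (fun i => (i : ℕ) < r)
        simp only [not_lt, card_univ, Fintype.card_fin] at h2
        omega
      have hsum : ∑ i ∈ univ.filter (fun i : Fin (m + 1) => r ≤ (i : ℕ)), ((w i : ℕ) + 1) =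
          (∑ i ∈ univ.filter (fun i : Fin m => r ≤ (i : ℕ)), ((w' i : ℕ) + 1)) +
            (m - r) + (p + 1) := by
        rw [sum_filter, Fin.sum_univ_castSucc]
        simp only [Fin.val_castSucc, Fin.val_last, hrm, if_true]
        rw [← sum_filter, ← hcard, card_eq_sum_ones, ← sum_add_distrib]
        congr 1
        refine sum_congr rfl fun i hi => ?_
        rw [hval i (by simpa using hi)]
      have hsign : (-1 : R) ^ ((m + 1 - r) * (m + 1) +
            ∑ i ∈ univ.filter (fun i : Fin (m + 1) => r ≤ (i : ℕ)), ((w i : ℕ) + 1)) =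
          (-1) ^ (m + p : ℕ) *
            (-1) ^ ((m - r) * m +
              ∑ i ∈ univ.filter (fun i : Fin m => r ≤ (i : ℕ)), ((w' i : ℕ) + 1)) := by
        rw [hsum, ← pow_add, show m + 1 - r = (m - r) + 1 by omega]
        generalize ∑ i ∈ univ.filter (fun i : Fin m => r ≤ (i : ℕ)), ((w' i : ℕ) + 1) = S
        rw [show (m - r + 1) * (m + 1) + (S + (m - r) + ((p : ℕ) + 1)) =
          (m + p + ((m - r) * m + S)) + 2 * (m - r + 1) by ring, pow_add _ _ (2 * _), pow_mul]
        simp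
      rw [Matrix.det_succ_row C (Fin.last m), sum_eq_single p
        (fun j _ hj => by rw [hC (Fin.last m) hrm j hj]; ring) (by simp),
        Fin.succAbove_last, key, hsub, hprod, hsign, Fin.val_last]
      ring

/-- Let `C` be an `n × n` matrix, `r ≤ n`, and suppose rows
`r+1, …, n` (1-based) each have a single possibly-nonzero entry, in column `ω_i`, where
`ω_{r+1} > ω_{r+2} > ⋯ > ω_n`.  Then
`det C = (−1)^{(n−r)n + Σω} (Π_{i=r+1}^n c_{i,ω_i}) det(sub_{{1,…,r}}^{{1,…,n}∖Q₁} C)`.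
Indices are encoded `0`-based by `Fin n` (the `1`-based value of `i : Fin n` is
`(i : ℕ) + 1`); `w : Fin n → Fin n` encodes `ω` on the rows `i` with `r ≤ (i : ℕ)`.
The submatrix `sub_{{1,…,r}}^{{1,…,n}∖Q₁} C` keeps the first `r` rows (equivalently,
since `|{1,…,n} ∖ Q₁| = r` here, the first `Q₁ᶜ.card` rows) and the columns in `Q₁ᶜ`
in increasing order. -/
theorem stmt_10 {R : Type*} [CommRing R] {n : ℕ} (r : ℕ) (hr : r ≤ n)
    (C : Matrix (Fin n) (Fin n) R) (w : Fin n → Fin n)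
    (hw : ∀ i j : Fin n, r ≤ (i : ℕ) → (i : ℕ) < (j : ℕ) → w j < w i)
    (hC : ∀ i : Fin n, r ≤ (i : ℕ) → ∀ j : Fin n, j ≠ w i → C i j = 0) :
    C.det =
      (-1 : R) ^ ((n - r) * n +
          ∑ i ∈ Finset.univ.filter (fun i : Fin n => r ≤ (i : ℕ)), ((w i : ℕ) + 1)) *
        (∏ i ∈ Finset.univ.filter (fun i : Fin n => r ≤ (i : ℕ)), C i (w i)) *
        Matrix.det (Matrix.of
          fun a b : Fin ((Finset.univ.filter (fun i : Fin n => r ≤ (i : ℕ))).image w)ᶜ.card =>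
            C ⟨(a : ℕ), lt_of_lt_of_le a.isLt
                (le_trans (Finset.card_le_univ _) (le_of_eq (Fintype.card_fin n)))⟩
              (((Finset.univ.filter (fun i : Fin n => r ≤ (i : ℕ))).image w)ᶜ.orderEmbOfFin
                rfl b)) := by
  set s := (Finset.univ.filter (fun i : Fin n => r ≤ (i : ℕ))).image w with hs
  have hinj : Set.InjOn w (Finset.univ.filter (fun i : Fin n => r ≤ (i : ℕ))) := by
    intro i hi j hj hij
    simp only [Finset.coe_filter, Finset.mem_univ, true_and, Set.mem_ofPred_eq] at hi hj
    rcases lt_trichotomy (i : ℕ) j with h | h | h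
    · exact absurd hij (hw i j hi h).ne'
    · exact Fin.ext h
    · exact absurd hij (hw j i hj h).ne
  have hcard : sᶜ.card = r := by
    have h1 := Fin.card_filter_val_lt (n := n) (m := r)
    have h2 := Finset.card_filter_add_card_filter_not (s := (Finset.univ : Finset (Fin n)))
      (fun i => (i : ℕ) < r)
    simp only [not_lt, Finset.card_univ, Fintype.card_fin] at h2
    rw [Finset.card_compl, hs, Finset.card_image_of_injOn hinj, Fintype.card_fin]
    omega
  rw [Matrix.det_of_single_entry_rows r hr C w hw hC
    (fun b => sᶜ.orderEmbOfFin rfl (Fin.cast hcard.symm b))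
    (fun a b hab => (sᶜ.orderEmbOfFin rfl).strictMono hab)
    (fun k i hi h => by
      have hmem := Finset.orderEmbOfFin_mem sᶜ rfl (Fin.cast hcard.symm k)
      rw [h, Finset.mem_compl] at hmem
      exact hmem (Finset.mem_image_of_mem w (by simpa using hi)))]
  congr 1
  rw [← Matrix.det_submatrix_equiv_self (finCongr hcard)]
  rfl
end

section
/- Let F be a finite field with q elements, let A be a commutative F-algebra, let W be an F-submodule of A that is a finite set, and let W₀ ⊆ W ∖ {0} be a set of line representatives, i.e., for every w ∈ W with w ≠ 0 there exist a unique α ∈ F ∖ {0} and a unique w' ∈ W₀ such that w = α • w'. Then for every v ∈ A, Π_{w ∈ W, w ≠ 0} (v + w) = Π_{w ∈ W₀} (v^{q−1} − w^{q−1}). -/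
open scoped Classical

/-- A finite field with `q` elements contains a primitive `(q - 1)`-th root of unity. -/
theorem FiniteField.exists_isPrimitiveRoot_card_sub_one (F : Type*) [Field F] [Fintype F] :
    ∃ ζ : F, IsPrimitiveRoot ζ (Fintype.card F - 1) := by
  obtain ⟨g, hg⟩ := IsCyclic.exists_generator (α := Fˣ)
  refine ⟨g, ?_⟩
  have h := IsPrimitiveRoot.orderOf g
  rw [orderOf_eq_card_of_forall_mem_zpowers hg, Nat.card_eq_fintype_card, Fintype.card_units] at h
  exact IsPrimitiveRoot.coe_units_iff.mpr h

/-- In a domain over a field `F` with `q` elements, the `(q - 1)`-th roots of unity are the nonzero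
elements of `F`. -/
theorem FiniteField.nthRootsFinset_card_sub_one {F R : Type*} [Field F] [Fintype F] [CommRing R]
    [IsDomain R] [DecidableEq R] [Algebra F R] :
    Polynomial.nthRootsFinset (Fintype.card F - 1) (1 : R) =
      (Finset.univ.filter fun α : F => α ≠ 0).image (algebraMap F R) := by
  have hpos : 0 < Fintype.card F - 1 := Nat.sub_pos_of_lt Fintype.one_lt_card
  have hinj : Function.Injective (algebraMap F R) := (algebraMap F R).injective
  obtain ⟨ζ, hζ⟩ := FiniteField.exists_isPrimitiveRoot_card_sub_one F
  symm
  apply Finset.eq_of_subset_of_card_le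
  · intro x hx
    obtain ⟨α, hα, rfl⟩ := Finset.mem_image.mp hx
    rw [Polynomial.mem_nthRootsFinset hpos, ← map_pow,
      FiniteField.pow_card_sub_one_eq_one α (Finset.mem_filter.mp hα).2, map_one]
  · rw [(hζ.map_of_injective hinj).card_nthRootsFinset, Finset.card_image_of_injective _ hinj,
      Finset.filter_ne', Finset.card_erase_of_mem (Finset.mem_univ _), Finset.card_univ]

/-- The homogeneous form of the factorization of `X ^ (q - 1) - 1` over a field with `q` elements,
valid in any commutative algebra. -/
theorem FiniteField.prod_add_smul_eq_pow_sub_pow {F A : Type*} [Field F] [Fintype F] [CommRing A]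
    [Algebra F A] (v w : A) :
    ∏ α : F with α ≠ 0, (v + α • w) =
      v ^ (Fintype.card F - 1) - w ^ (Fintype.card F - 1) := by
  have hpos : 0 < Fintype.card F - 1 := Nat.sub_pos_of_lt Fintype.one_lt_card
  obtain ⟨ζ, hζ⟩ := FiniteField.exists_isPrimitiveRoot_card_sub_one F
  have hinj : Function.Injective (algebraMap F (MvPolynomial (Fin 2) F)) :=
    (algebraMap F _).injective
  have key := (hζ.map_of_injective hinj).pow_sub_pow_eq_prod_sub_mul
    (MvPolynomial.X 0) (MvPolynomial.X 1) hpos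
  rw [FiniteField.nthRootsFinset_card_sub_one, Finset.prod_image (fun _ _ _ _ h => hinj h)] at key
  have := congrArg (MvPolynomial.aeval ![v, w]) key
  simp only [map_sub, map_pow, map_prod, MvPolynomial.aeval_X,
    Matrix.cons_val_zero, Matrix.cons_val_one, ← Algebra.smul_def] at this
  rw [this]
  refine Finset.prod_equiv (Equiv.neg F) (by simp) fun α _ => ?_
  simp

/-- Let `F` be a finite field with `q` elements, `A` a commutative
`F`-algebra, `W` a finite `F`-submodule of `A`, and `W₀ ⊆ W ∖ {0}` a set of line
representatives (every nonzero `w ∈ W` is uniquely `α • w'` with `α ∈ F ∖ {0}` and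
`w' ∈ W₀`). Then for every `v ∈ A`:
`Π_{w ∈ W, w ≠ 0} (v + w) = Π_{w ∈ W₀} (v^{q−1} − w^{q−1})`. -/
theorem stmt_12 {F A : Type*} [Field F] [Fintype F] [CommRing A] [Algebra F A]
    (W : Submodule F A) (hW : (W : Set A).Finite) (W₀ : Finset A)
    (hW₀ : ↑W₀ ⊆ (W : Set A) \ {0})
    (hrep : ∀ w ∈ W, w ≠ 0 →
      ∃! p : F × A, p.1 ≠ 0 ∧ p.2 ∈ W₀ ∧ w = p.1 • p.2)
    (v : A) :
    ∏ w ∈ hW.toFinset.filter (fun w => w ≠ 0), (v + w) =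
      ∏ w ∈ W₀, (v ^ (Fintype.card F - 1) - w ^ (Fintype.card F - 1)) := by
  have hmem (p : F × A) (h1 : p.1 ≠ 0) (h2 : p.2 ∈ W₀) : p.1 • p.2 ∈ W ∧ p.1 • p.2 ≠ 0 :=
    ⟨W.smul_mem _ (hW₀ h2).1, smul_ne_zero h1 (hW₀ h2).2⟩
  simp_rw [← FiniteField.prod_add_smul_eq_pow_sub_pow (F := F)]
  rw [← Finset.prod_product_right']
  symm
  refine Finset.prod_bij (fun p _ => p.1 • p.2) ?_ ?_ ?_ ?_
  · intro p hp
    simp only [Finset.mem_product, Finset.mem_filter, Finset.mem_univ, true_and] at hp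
    simpa using hmem p hp.1 hp.2
  · intro p hp p' hp' h
    simp only [Finset.mem_product, Finset.mem_filter, Finset.mem_univ, true_and] at hp hp'
    obtain ⟨h1, h2⟩ := hmem p hp.1 hp.2
    exact (hrep _ h1 h2).unique ⟨hp.1, hp.2, rfl⟩ ⟨hp'.1, hp'.2, h⟩
  · intro w hw
    simp only [Finset.mem_filter, Set.Finite.mem_toFinset, SetLike.mem_coe] at hw
    obtain ⟨p, ⟨h1, h2, h3⟩, -⟩ := hrep w hw.1 hw.2
    exact ⟨p, by simp [h1, h2], h3.symm⟩
  · intro p _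
    rfl
end

section
/- Let F be a finite field with q elements, let A be a commutative F-algebra, and let V be an F-submodule of A that is a finite set. Then for all a, b ∈ F, the following identity holds in the polynomial ring A[t,u] in two variables: Π_{v ∈ V} (a•t + b•u + v) = a • Π_{v ∈ V} (t + v) + b • Π_{v ∈ V} (u + v), where elements v ∈ V ⊆ A are regarded as constant polynomials, a•t and b•u denote the scalar multiples of the variables t and u by a and b, and a • (−), b • (−) on the right-hand side denote the F-scalar action on A[t,u]. -/
open scoped Classical

namespace FiniteField

open Polynomial in
theorem prod_X_sub_C_eq_X_pow_card_sub_X (F : Type*) [Field F] [Fintype F] :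
    ∏ c : F, (X - C c) = X ^ Fintype.card F - X := by
  have hq : 1 < Fintype.card F := Fintype.one_lt_card
  have hroots := roots_X_pow_card_sub_X F
  have hmonic : (X ^ Fintype.card F - X : F[X]).Monic :=
    monic_X_pow_sub (by simpa using hq)
  have h := prod_multiset_X_sub_C_of_monic_of_roots_card_eq hmonic (by
    rw [hroots, X_pow_card_sub_X_natDegree_eq F hq]
    rfl)
  rwa [hroots] at h

/-- The homogeneous form of `∏ c, (X - C c) = X ^ q - X`. -/
theorem prod_add_smul {F B : Type*} [Field F] [Fintype F] [CommRing B] [Algebra F B] (s y : B) :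
    ∏ c : F, (s + c • y) = s ^ Fintype.card F - y ^ (Fintype.card F - 1) * s := by
  have h := congrArg (fun p ↦ MvPolynomial.aeval ![s, y] (p.homogenize (Fintype.card F)))
    (prod_X_sub_C_eq_X_pow_card_sub_X F)
  have hprod := Polynomial.homogenize_finsetProd (s := Finset.univ) (n := fun _ : F ↦ 1)
    (p := fun c : F ↦ Polynomial.X - Polynomial.C c) (by simp)
  simp only [Finset.sum_const, Finset.card_univ, smul_eq_mul, mul_one] at hprod
  rw [hprod] at h
  rw [← Equiv.prod_comp (Equiv.neg F)]
  simpa [Polynomial.homogenize_X_pow, Polynomial.homogenize_X, Algebra.smul_def,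
    sub_eq_add_neg, mul_comm] using h

/-- The product `∏ w, (t + w)` over the `F`-combinations `w` of finitely many elements `x i`
is `F`-linear in `t`. -/
theorem exists_linearMap_eq_prod_add_sum_smul {F B : Type*} [Field F] [Fintype F] [CommRing B]
    [Algebra F B] {n : ℕ} (x : Fin n → B) :
    ∃ L : B →ₗ[F] B, ∀ t, L t = ∏ c : Fin n → F, (t + ∑ i, c i • x i) := by
  induction n with
  | zero => exact ⟨LinearMap.id, fun t ↦ by simp⟩
  | succ n ih =>
    obtain ⟨L, hL⟩ := ih (Fin.tail x)
    refine ⟨((frobeniusAlgHom F B).toLinearMap -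
      LinearMap.mulLeft F (L (x 0) ^ (Fintype.card F - 1))) ∘ₗ L, fun t ↦ ?_⟩
    rw [← Equiv.prod_comp (Fin.consEquiv fun _ ↦ F), Fintype.prod_prod_type]
    calc
      _ = ∏ c : F, L (t + c • x 0) := by simp [prod_add_smul]
      _ = _ := by simp [hL, Fin.sum_univ_succ, Fin.tail, add_assoc]

theorem exists_linearMap_eq_prod_add {F M B : Type*} [Field F] [Fintype F] [AddCommGroup M]
    [Module F M] [Fintype M] [CommRing B] [Algebra F B] (φ : M →ₗ[F] B) :
    ∃ L : B →ₗ[F] B, ∀ t, L t = ∏ v : M, (t + φ v) := by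
  let e := Module.finBasis F M
  obtain ⟨L, hL⟩ := exists_linearMap_eq_prod_add_sum_smul (F := F) (φ ∘ e)
  refine ⟨L, fun t ↦ ?_⟩
  rw [hL, ← Equiv.prod_comp e.equivFun.symm.toEquiv]
  simp [Module.Basis.equivFun_symm_apply]

end FiniteField

/-- Let `F` be a finite field, `A` a commutative `F`-algebra, and `V`
a finite `F`-submodule of `A`. Then in `A[t,u]` (with `t = X 0`, `u = X 1`), for all
`a, b ∈ F`:
`Π_{v ∈ V} (a•t + b•u + v) = a • Π_{v ∈ V} (t + v) + b • Π_{v ∈ V} (u + v)`. -/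
theorem stmt_13 {F A : Type*} [Field F] [Fintype F] [CommRing A] [Algebra F A]
    (V : Submodule F A) (hV : (V : Set A).Finite) (a b : F) :
    ∏ v ∈ hV.toFinset,
        (a • MvPolynomial.X 0 + b • MvPolynomial.X 1 + MvPolynomial.C v :
          MvPolynomial (Fin 2) A) =
      a • ∏ v ∈ hV.toFinset,
          (MvPolynomial.X 0 + MvPolynomial.C v : MvPolynomial (Fin 2) A) +
        b • ∏ v ∈ hV.toFinset,
          (MvPolynomial.X 1 + MvPolynomial.C v : MvPolynomial (Fin 2) A) := by
  have : Fintype V := hV.fintype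
  obtain ⟨L, hL⟩ := FiniteField.exists_linearMap_eq_prod_add
    ((IsScalarTower.toAlgHom F A (MvPolynomial (Fin 2) A)).toLinearMap ∘ₗ V.subtype)
  have hprod (t : MvPolynomial (Fin 2) A) :
      ∏ v ∈ hV.toFinset, (t + MvPolynomial.C v) = L t := by
    rw [hL, Finset.prod_subtype hV.toFinset (p := (· ∈ V)) (by simp)]
    rfl
  simp only [hprod, map_add, map_smul]
end

section
/- Let F be a finite field, let A be a commutative F-algebra which is an integral domain, and let U ⊆ V be F-submodules of A that are finite sets. Define g : A → A by g(v) := Π_{u ∈ U} (v + u), and let W := g(V) = {g(v) : v ∈ V} be the (finite) image of V under g. Then in the polynomial ring A[t], Π_{v ∈ V} (t + v) = Π_{w ∈ W} ( f_U(t) + w ), where f_U(t) := Π_{u ∈ U} (t + u) ∈ A[t], elements of A are regarded as constant polynomials, and the product over W is over its distinct elements. -/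
open scoped Classical

open Polynomial in
/-- The polynomial with the elements of a finite additive subgroup as roots is additive,
up to evaluation of the translate. -/
theorem AddSubgroup.prod_X_add_C_translate {A : Type*} [CommRing A] [IsDomain A]
    (U : AddSubgroup A) (hU : (U : Set A).Finite) (a : A) :
    ∏ u ∈ hU.toFinset, (X + C (a + u)) =
      (∏ u ∈ hU.toFinset, (X + C u)) + C (∏ u ∈ hU.toFinset, (a + u)) := by
  have hne : hU.toFinset.Nonempty := ⟨0, by simp [U.zero_mem]⟩
  have monic (b : A) : (∏ u ∈ hU.toFinset, (X + C (b + u))).Monic :=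
    monic_prod_of_monic _ _ fun u _ => monic_X_add_C _
  have degree (b : A) :
      (∏ u ∈ hU.toFinset, (X + C (b + u))).degree = (hU.toFinset.card : WithBot ℕ) := by
    simp only [degree_prod, degree_X_add_C, Finset.sum_const, nsmul_one]
  have monic' := monic 0
  have degree' := degree 0
  simp only [zero_add] at monic' degree'
  rw [← sub_eq_iff_eq_add']
  refine eq_of_degree_sub_lt_of_eval_finset_eq hU.toFinset ?_ fun x hx => ?_
  · refine (degree_sub_le _ _).trans_lt (max_lt ?_ ?_)
    · rw [← degree a]
      exact degree_sub_lt_left ((degree a).trans degree'.symm)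
        (monic a).ne_zero ((monic a).leadingCoeff.trans monic'.leadingCoeff.symm)
    · exact degree_C_le.trans_lt (by exact_mod_cast hne.card_pos)
  · replace hx : x ∈ U := by simpa using hx
    have root : ∏ u ∈ hU.toFinset, (x + u) = 0 :=
      Finset.prod_eq_zero (i := -x) (by simpa using hx) (by simp)
    simp only [eval_sub, eval_prod, eval_add, eval_X, eval_C, root, sub_zero]
    refine Finset.prod_bij (fun u _ => x + u) ?_ ?_ ?_ ?_
    · intro u hu
      simp only [Set.Finite.mem_toFinset, SetLike.mem_coe] at hu ⊢
      exact U.add_mem hx hu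
    · intro u _ w _ h
      exact add_left_cancel h
    · intro u hu
      simp only [Set.Finite.mem_toFinset, SetLike.mem_coe] at hu
      exact ⟨-x + u, by simpa using U.add_mem (U.neg_mem hx) hu, by simp⟩
    · intro u _
      ring

open Polynomial in
/-- Two elements have the same product over their translates by a finite additive subgroup
exactly when they differ by an element of the subgroup. -/
theorem AddSubgroup.prod_add_eq_prod_add_iff {A : Type*} [CommRing A] [IsDomain A]
    (U : AddSubgroup A) (hU : (U : Set A).Finite) (a b : A) :
    ∏ u ∈ hU.toFinset, (a + u) = ∏ u ∈ hU.toFinset, (b + u) ↔ a - b ∈ U := by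
  have h := congrArg (eval (a - b)) (U.prod_X_add_C_translate hU b)
  simp only [eval_prod, eval_add, eval_X, eval_C, ← add_assoc, sub_add_cancel] at h
  rw [h, add_eq_right, Finset.prod_eq_zero_iff]
  constructor
  · rintro ⟨u, hu, h0⟩
    rw [eq_neg_of_add_eq_zero_left h0]
    exact U.neg_mem (by simpa using hu)
  · intro hab
    exact ⟨-(a - b), hU.mem_toFinset.2 (U.neg_mem hab), by simp⟩

/-- Let `F` be a finite field, `A` a commutative `F`-algebra that is
an integral domain, and `U ⊆ V` finite `F`-submodules of `A`.  With
`g(v) = Π_{u ∈ U} (v + u)` and `W = g(V)`, one has in `A[t]`: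
`Π_{v ∈ V} (t + v) = Π_{w ∈ W} (f_U(t) + w)` where `f_U(t) = Π_{u ∈ U} (t + u)`. -/
theorem stmt_14 {F A : Type*} [Field F] [Fintype F] [CommRing A] [IsDomain A]
    [Algebra F A] (U V : Submodule F A) (hUV : U ≤ V)
    (hU : (U : Set A).Finite) (hV : (V : Set A).Finite) :
    ∏ v ∈ hV.toFinset, (Polynomial.X + Polynomial.C v) =
      ∏ w ∈ hV.toFinset.image (fun v => ∏ u ∈ hU.toFinset, (v + u)),
        ((∏ u ∈ hU.toFinset, (Polynomial.X + Polynomial.C u)) + Polynomial.C w) := by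
  refine (Finset.prod_image' _ fun a ha => ?_).symm
  have key := U.toAddSubgroup.prod_X_add_C_translate hU a
  rw [Set.Finite.mem_toFinset] at ha
  refine key.symm.trans (Finset.prod_bij (fun u _ => a + u) ?_ ?_ ?_ ?_)
  · intro u hu
    rw [Set.Finite.mem_toFinset] at hu
    rw [Finset.mem_filter, Set.Finite.mem_toFinset]
    refine ⟨V.add_mem ha (hUV hu), ?_⟩
    refine (U.toAddSubgroup.prod_add_eq_prod_add_iff hU _ _).2 ?_
    rw [add_sub_cancel_left]
    exact hu
  · intro u _ w _ h
    exact add_left_cancel h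
  · intro b hb
    rw [Finset.mem_filter] at hb
    refine ⟨b - a, ?_, add_sub_cancel a b⟩
    rw [Set.Finite.mem_toFinset]
    exact (U.toAddSubgroup.prod_add_eq_prod_add_iff hU _ _).1 hb.2
  · intro u _
    rfl
end

section
/- Let λ, μ, α, β be partitions with μ ⊆ λ and β ⊆ α (pointwise inequalities μ_i ≤ λ_i and β_i ≤ α_i for all i ≥ 1). Assume that the skew diagrams λ−μ and α−β coincide, i.e., for all integers i ≥ 1 and j ≥ 1 one has (μ_i < j ≤ λ_i) if and only if (β_i < j ≤ α_i). Let n ∈ ℕ be such that λ_i = μ_i = α_i = β_i = 0 for all i > n. Then S_n(λ,μ;0) = S_n(α,β;0). -/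
/-- The base ring of the ninth variation: polynomials over `ℤ` in indeterminates
`X_{(r,s)}` indexed by pairs of a positive integer `r` and an integer `s`. -/
abbrev NinthR : Type := MvPolynomial ({r : ℤ // 0 < r} × ℤ) ℤ

/-- `hfun r s` is `h_{r,s}`: the indeterminate `X_{(r,s)}` if `r > 0`, `1` if `r = 0`,
and `0` if `r < 0`. -/
noncomputable def hfun (r s : ℤ) : NinthR :=
  if hr : 0 < r then MvPolynomial.X (⟨r, hr⟩, s) else if r = 0 then 1 else 0

/-- The ninth-variation skew Schur function `S_n(λ,μ;s)`: the determinant of the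
`n × n` matrix whose `(i,j)` entry (`1 ≤ i,j ≤ n`, here encoded by `Fin n` with the
`1`-based index `(i : ℕ) + 1`) is `h(λ_i − μ_j − i + j, μ_j − j + 1 + s)`.
Partitions are encoded as functions `ℕ → ℕ` whose relevant values are at indices
`1, 2, 3, …`. -/
noncomputable def Svar (n : ℕ) (l m : ℕ → ℕ) (s : ℤ) : NinthR :=
  Matrix.det (Matrix.of fun i j : Fin n =>
    hfun ((l ((i : ℕ) + 1) : ℤ) - (m ((j : ℕ) + 1) : ℤ)
        - (((i : ℕ) : ℤ) + 1) + (((j : ℕ) : ℤ) + 1))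
      ((m ((j : ℕ) + 1) : ℤ) - (((j : ℕ) : ℤ) + 1) + 1 + s))

lemma le_of_forall_succ_le {f : ℕ → ℕ} (hf : ∀ i, 1 ≤ i → f (i + 1) ≤ f i) {a b : ℕ}
    (ha : 1 ≤ a) (hab : a ≤ b) : f b ≤ f a := by
  induction b, hab using Nat.le_induction with
  | base => exact le_rfl
  | succ k hk ih => exact (hf k (ha.trans hk)).trans ih

lemma hfun_of_neg {r : ℤ} (hr : r < 0) (s : ℤ) : hfun r s = 0 := by
  simp [hfun, hr.ne, hr.le]

lemma hfun_zero (s : ℤ) : hfun 0 s = 1 := by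
  simp [hfun]

open Classical in
/-- Labels the rows of a skew diagram (row `i + 1` being empty when `E i`) so that each empty row
and each maximal run of consecutive nonempty rows is one block. -/
noncomputable def rowBlock (E : ℕ → Prop) (i : ℕ) : ℕ :=
  Nat.count E i + Nat.count E (i + 1)

lemma exists_of_rowBlock_lt {E : ℕ → Prop} {i j : ℕ} (h : rowBlock E j < rowBlock E i) :
    j < i ∧ ∃ k, j ≤ k ∧ k ≤ i ∧ E k := by
  classical
  unfold rowBlock at h
  have hji : j < i := by
    by_contra! hij
    have h₁ := Nat.count_monotone E hij
    have h₂ := Nat.count_monotone E (Nat.succ_le_succ hij)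
    simp only [Nat.succ_eq_add_one] at h₂
    omega
  refine ⟨hji, ?_⟩
  have h₁ := Nat.count_monotone E (Nat.le_succ i)
  have h₂ := Nat.count_monotone E (Nat.le_succ j)
  simp only [Nat.succ_eq_add_one] at h₁ h₂
  have hlt : Nat.count E j < Nat.count E (i + 1) := by omega
  obtain ⟨k, hk, hE⟩ := Nat.exists_of_count_lt_count hlt
  exact ⟨k, hk.1, Nat.lt_succ_iff.mp hk.2, hE⟩

lemma rowBlock_lt_of_lt {E : ℕ → Prop} {i j : ℕ} (hij : i < j) (h : E i ∨ E j) :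
    rowBlock E i < rowBlock E j := by
  classical
  unfold rowBlock
  have h₁ := Nat.count_monotone E hij.le
  have h₂ := Nat.count_monotone E (Nat.succ_le_succ hij.le)
  simp only [Nat.succ_eq_add_one] at h₂
  rcases h with h | h
  · have := Nat.count_strict_mono h hij
    omega
  · have := Nat.count_strict_mono h (Nat.lt_succ_self j)
    have := Nat.count_monotone E (Nat.succ_le_of_lt hij)
    simp only [Nat.succ_eq_add_one] at *
    omega

/-- The matrix defining `Svar` is block triangular for the blocks cut out by empty rows. -/
lemma blockTriangular_Svar {l m : ℕ → ℕ} (hl : ∀ i, 1 ≤ i → l (i + 1) ≤ l i)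
    (hm : ∀ i, 1 ≤ i → m (i + 1) ≤ m i) {E : ℕ → Prop}
    (hE : ∀ i, E i → l (i + 1) = m (i + 1)) (n : ℕ) (s : ℤ) :
    (Matrix.of fun i j : Fin n =>
      hfun ((l ((i : ℕ) + 1) : ℤ) - (m ((j : ℕ) + 1) : ℤ)
          - (((i : ℕ) : ℤ) + 1) + (((j : ℕ) : ℤ) + 1))
        ((m ((j : ℕ) + 1) : ℤ) - (((j : ℕ) : ℤ) + 1) + 1 + s)).BlockTriangular
      fun i => rowBlock E i := by
  intro i j hij
  obtain ⟨hji, k, hjk, hki, hk⟩ := exists_of_rowBlock_lt hij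
  have h₁ := le_of_forall_succ_le hl (Nat.le_add_left 1 k) (Nat.succ_le_succ hki)
  have h₂ := le_of_forall_succ_le hm (Nat.le_add_left 1 j) (Nat.succ_le_succ hjk)
  have h₃ := hE k hk
  simp only [Nat.succ_eq_add_one] at h₁ h₂
  exact hfun_of_neg (by omega) _

/-- The ninth-variation skew Schur function depends only on the skew
diagram: if `μ ⊆ λ`, `β ⊆ α` are partitions with all parts vanishing beyond `n` and
with equal skew diagrams `λ−μ = α−β`, then `S_n(λ,μ;0) = S_n(α,β;0)`. -/
theorem stmt_15 (l μ α β : ℕ → ℕ)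
    (hl : ∀ i, 1 ≤ i → l (i + 1) ≤ l i) (hμ : ∀ i, 1 ≤ i → μ (i + 1) ≤ μ i)
    (hα : ∀ i, 1 ≤ i → α (i + 1) ≤ α i) (hβ : ∀ i, 1 ≤ i → β (i + 1) ≤ β i)
    (hμl : ∀ i, 1 ≤ i → μ i ≤ l i) (hβα : ∀ i, 1 ≤ i → β i ≤ α i)
    (n : ℕ) (hn : ∀ i, n < i → l i = 0 ∧ μ i = 0 ∧ α i = 0 ∧ β i = 0)
    (hshape : ∀ i j, 1 ≤ i → 1 ≤ j → ((μ i < j ∧ j ≤ l i) ↔ (β i < j ∧ j ≤ α i))) :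
    Svar n l μ 0 = Svar n α β 0 := by
  have hrow : ∀ i, 1 ≤ i → (l i = μ i ∧ α i = β i) ∨ (l i = α i ∧ μ i = β i) := by
    intro i hi
    have h₁ := hμl i hi
    have h₂ := hβα i hi
    have h₃ := hshape i (l i) hi
    have h₄ := hshape i (α i) hi
    have h₅ := hshape i (μ i + 1) hi
    have h₆ := hshape i (β i + 1) hi
    omega
  let E : ℕ → Prop := fun i => l (i + 1) = μ (i + 1) ∧ α (i + 1) = β (i + 1)
  unfold Svar
  rw [(blockTriangular_Svar hl hμ (E := E) (fun _ h => h.1) n 0).det,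
    (blockTriangular_Svar hα hβ (E := E) (fun _ h => h.2) n 0).det]
  refine Finset.prod_congr rfl fun a _ => congrArg Matrix.det ?_
  ext1 ⟨i, hi⟩ ⟨j, hj⟩
  simp only [Matrix.toSquareBlock_def, Matrix.of_apply]
  have hb : rowBlock E i = rowBlock E j := hi.trans hj.symm
  by_cases h : E i ∨ E j
  · obtain rfl : i = j := by
      rcases lt_trichotomy (i : ℕ) j with hij | hij | hij
      · exact absurd hb (rowBlock_lt_of_lt hij h).ne
      · exact Fin.ext hij
      · exact absurd hb (rowBlock_lt_of_lt hij h.symm).ne'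
    obtain ⟨h₁, h₂⟩ : E i := h.elim id id
    simp [h₁, h₂, hfun_zero]
  · obtain ⟨hi', hj'⟩ := not_or.mp h
    obtain ⟨h₁, -⟩ := (hrow (i + 1) (Nat.le_add_left 1 _)).resolve_left hi'
    obtain ⟨-, h₂⟩ := (hrow (j + 1) (Nat.le_add_left 1 _)).resolve_left hj'
    rw [h₁, h₂]
end
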